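/- arXiv:1810.11911 — 2 statements merged into one kernel-verified Lean document; each statement's English description precedes it below -/
import Mathlib

section
/- Let A : ℝ^d → ℝ be convex and differentiable, let θ_1, …, θ_n ∈ ℝ^d, and let w_1, …, w_n ≥ 0 with W := Σ_{i=1}^n w_i > 0. Then the weighted mean θ̄ := (1/W) Σ_{i=1}^n w_i θ_i is a global minimizer over s ∈ ℝ^d of the function s ↦ Σ_{i=1}^n w_i D_A(θ_i, s), and the minimum value is Σ_{i=1}^n w_i D_A(θ_i, θ̄). -/
open Finset
open scoped RealInnerProductSpace

/-- The first-order condition: a convex function lies above its tangent hyperplanes. -/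
theorem ConvexOn.add_inner_gradient_le {E : Type*} [NormedAddCommGroup E] [InnerProductSpace ℝ E]
    [CompleteSpace E] {f : E → ℝ} (hf : ConvexOn ℝ Set.univ f) {y : E}
    (hy : DifferentiableAt ℝ f y) (x : E) : f y + ⟪gradient f y, x - y⟫ ≤ f x := by
  have hconv : ConvexOn ℝ Set.univ (f ∘ AffineMap.lineMap (k := ℝ) y x) := by
    simpa using hf.comp_affineMap (AffineMap.lineMap (k := ℝ) y x)
  have hderiv : HasDerivAt (f ∘ AffineMap.lineMap (k := ℝ) y x) ⟪gradient f y, x - y⟫ 0 := by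
    have hgrad : HasFDerivAt f (InnerProductSpace.toDual ℝ E (gradient f y))
        (AffineMap.lineMap (k := ℝ) y x 0) := by
      simpa using hy.hasGradientAt.hasFDerivAt
    simpa using hgrad.comp_hasDerivAt (0 : ℝ) AffineMap.hasDerivAt_lineMap
  have hslope := hconv.le_slope_of_hasDerivAt (Set.mem_univ 0) (Set.mem_univ 1) one_pos hderiv
  simp only [slope_def_field, Function.comp_apply, AffineMap.lineMap_apply_one,
    AffineMap.lineMap_apply_zero, sub_zero, div_one] at hslope
  linarith

/-- For convex differentiable `A`, the weighted mean `θ̄ = (1/W) Σ_i w_i θ_i` is a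
global minimizer of `s ↦ Σ_i w_i D_A(θ_i, s)`, the minimum value being `Σ_i w_i D_A(θ_i, θ̄)`. -/
theorem stmt_5 {d n : ℕ} (A : EuclideanSpace ℝ (Fin d) → ℝ)
    (hA : ConvexOn ℝ Set.univ A) (hA' : Differentiable ℝ A)
    (θ : Fin n → EuclideanSpace ℝ (Fin d))
    (w : Fin n → ℝ) (hw : ∀ i, 0 ≤ w i)
    (W : ℝ) (hW : W = ∑ i, w i) (hWpos : 0 < W)
    (θbar : EuclideanSpace ℝ (Fin d)) (hθbar : θbar = (1 / W) • ∑ i, w i • θ i)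
    (D : EuclideanSpace ℝ (Fin d) → EuclideanSpace ℝ (Fin d) → ℝ)
    (hD : ∀ x y, D x y = A x - A y - ⟪gradient A y, x - y⟫) :
    ∀ s, ∑ i, w i * D (θ i) θbar ≤ ∑ i, w i * D (θ i) s := by
  intro s
  have hsum : ∑ i, w i • θ i = W • θbar := by
    rw [hθbar, smul_smul, mul_one_div_cancel hWpos.ne', one_smul]
  have hdecomp (y : EuclideanSpace ℝ (Fin d)) :
      ∑ i, w i * D (θ i) y = ∑ i, w i * A (θ i) - W * (A y + ⟪gradient A y, θbar - y⟫) := by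
    have hinner : ∑ i, w i * ⟪gradient A y, θ i - y⟫ = W * ⟪gradient A y, θbar - y⟫ := by
      simp_rw [← real_inner_smul_right, ← inner_sum, smul_sub, sum_sub_distrib, ← sum_smul]
      rw [hsum, ← hW]
    simp_rw [hD, mul_sub, sum_sub_distrib, hinner, ← sum_mul, ← hW]
    ring
  rw [hdecomp, hdecomp, sub_self, inner_zero_right, add_zero]
  gcongr
  exact hA.add_inner_gradient_le (hA' s) θbar
end

section
/- Let A : ℝ^d → ℝ be convex and differentiable, let λ > 0, let J, L ≥ 1 and a_1, …, a_J ≥ 0, and for each j let K_j ≥ 1, ω^j ∈ Δ^{K_j}, and θ^j_u ∈ ℝ^d (1 ≤ u ≤ K_j). For w ∈ Δ^L and Ψ = (ψ_1, …, ψ_L) ∈ (ℝ^d)^L define h(w, Ψ) := Σ_{j=1}^J a_j · inf { Σ_{u,v} π_{uv} D_A(θ^j_u, ψ_v) + λ Σ_{u,v} π_{uv} log π_{uv} : π ∈ Π(ω^j, w) }, where Π(ω^j, w) is the set of nonnegative K_j × L matrices with row sums ω^j and column sums w. Fix w ∈ Δ^L and Ψ, and suppose that for each j the matrix π^j ∈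 Π(ω^j, w) attains the inner infimum at (w, Ψ). Assume S_v := Σ_j Σ_u a_j π^j_{uv} > 0 for each v, and define Ψ' = (ψ'_1, …, ψ'_L) by ψ'_v := (1/S_v) Σ_{j=1}^J Σ_{u=1}^{K_j} a_j π^j_{uv} θ^j_u. Then h(w, Ψ') ≤ h(w, Ψ). -/
open Finset
open scoped RealInnerProductSpace

/-- The Bregman divergence of `A`. -/
noncomputable def bregmanDiv {E : Type*} [NormedAddCommGroup E] [InnerProductSpace ℝ E]
    [CompleteSpace E] (A : E → ℝ) (x y : E) : ℝ :=
  A x - A y - ⟪gradient A y, x - y⟫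

section Bregman

variable {E : Type*} [NormedAddCommGroup E] [InnerProductSpace ℝ E] [CompleteSpace E] {A : E → ℝ}

theorem bregmanDiv_nonneg (hA : ConvexOn ℝ Set.univ A) {y : E} (hy : DifferentiableAt ℝ A y)
    (x : E) : 0 ≤ bregmanDiv A x y := by
  have hline : ConvexOn ℝ Set.univ (A ∘ AffineMap.lineMap (k := ℝ) y x) :=
    hA.comp_affineMap (AffineMap.lineMap y x)
  have hderiv : HasDerivAt (A ∘ AffineMap.lineMap (k := ℝ) y x) ⟪gradient A y, x - y⟫ 0 := by
    have hy' : HasFDerivAt A (fderiv ℝ A y) (AffineMap.lineMap (k := ℝ) y x 0) := by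
      simpa using hy.hasFDerivAt
    have h := hy'.comp_hasDerivAt (0 : ℝ) AffineMap.hasDerivAt_lineMap
    simpa [gradient] using h
  have h := hline.le_slope_of_hasDerivAt (Set.mem_univ 0) (Set.mem_univ 1) one_pos hderiv
  simp only [slope_def_field, Function.comp_apply, AffineMap.lineMap_apply_zero,
    AffineMap.lineMap_apply_one, sub_zero, div_one] at h
  unfold bregmanDiv
  linarith

theorem bregmanDiv_sub_bregmanDiv (x y z : E) :
    bregmanDiv A x y - bregmanDiv A x z =
      bregmanDiv A z y + ⟪gradient A z - gradient A y, x - z⟫ := by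
  simp only [bregmanDiv, inner_sub_left, inner_sub_right]
  ring

/-- The weighted mean minimizes the weighted sum of Bregman divergences in the second argument. -/
theorem sum_mul_bregmanDiv_mean_le {ι : Type*} [Fintype ι] (hA : ConvexOn ℝ Set.univ A)
    {p : ι → ℝ} (hp : 0 < ∑ i, p i) (x : ι → E) {y : E} (hy : DifferentiableAt ℝ A y) {z : E}
    (hz : z = (1 / ∑ i, p i) • ∑ i, p i • x i) :
    ∑ i, p i * bregmanDiv A (x i) z ≤ ∑ i, p i * bregmanDiv A (x i) y := by
  have hmean : ∑ i, p i • (x i - z) = 0 := by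
    simp only [smul_sub, sum_sub_distrib, ← sum_smul]
    rw [hz, smul_smul, mul_one_div_cancel hp.ne', one_smul, sub_self]
  have hinner : ∑ i, p i * ⟪gradient A z - gradient A y, x i - z⟫ = 0 := by
    simp only [← real_inner_smul_right, ← inner_sum, hmean, inner_zero_right]
  have hdiff : ∑ i, p i * bregmanDiv A (x i) y - ∑ i, p i * bregmanDiv A (x i) z =
      (∑ i, p i) * bregmanDiv A z y := by
    simp only [← sum_sub_distrib, ← mul_sub, bregmanDiv_sub_bregmanDiv, mul_add, sum_add_distrib,
      hinner, add_zero, sum_mul]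
  have := mul_nonneg hp.le (bregmanDiv_nonneg hA hy z)
  linarith

end Bregman

theorem neg_one_le_mul_log {x : ℝ} (hx : 0 ≤ x) : -1 ≤ x * Real.log x := by
  rcases hx.eq_or_lt with rfl | hx
  · simp
  · have h := mul_le_mul_of_nonneg_left (Real.one_sub_inv_le_log_of_pos hx) hx.le
    rw [mul_sub, mul_inv_cancel₀ hx.ne'] at h
    linarith

/-- The entropic transport cost is bounded below on nonnegative plans when the cost is
nonnegative. -/
theorem entropic_cost_lower_bound {m n : Type*} [Fintype m] [Fintype n] {lam : ℝ} (hlam : 0 ≤ lam)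
    {C π : m → n → ℝ} (hC : ∀ u v, 0 ≤ C u v) (hπ : ∀ u v, 0 ≤ π u v) :
    lam * ∑ _u : m, ∑ _v : n, (-1 : ℝ) ≤
      ∑ u, ∑ v, π u v * C u v + lam * ∑ u, ∑ v, π u v * Real.log (π u v) := by
  have hcost : 0 ≤ ∑ u, ∑ v, π u v * C u v :=
    sum_nonneg fun u _ => sum_nonneg fun v _ => mul_nonneg (hπ u v) (hC u v)
  have hent : ∑ _u : m, ∑ _v : n, (-1 : ℝ) ≤ ∑ u, ∑ v, π u v * Real.log (π u v) :=
    sum_le_sum fun u _ => sum_le_sum fun v _ => neg_one_le_mul_log (hπ u v)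
  have := mul_le_mul_of_nonneg_left hent hlam
  linarith

/-- The weighted-mean atom update of the regularized composite transportation
barycenter algorithm does not increase the objective
`h(w, Ψ) = Σ_j a_j · inf { Σ_{u,v} π_{uv} D_A(θ^j_u, ψ_v) + λ Σ_{u,v} π_{uv} log π_{uv} :
π ∈ Π(ω^j, w) }`: if `π^j ∈ Π(ω^j, w)` attains the inner infimum at `(w, Ψ)`, and
`ψ'_v = (1/S_v) Σ_j Σ_u a_j π^j_{uv} θ^j_u` with `S_v = Σ_j Σ_u a_j π^j_{uv} > 0`, then
`h(w, Ψ') ≤ h(w, Ψ)`. -/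
theorem stmt_13 {d : ℕ} (A : EuclideanSpace ℝ (Fin d) → ℝ)
    (hA : ConvexOn ℝ Set.univ A) (hA' : Differentiable ℝ A)
    (lam : ℝ) (hlam : 0 < lam)
    (J L : ℕ) (hJ : 1 ≤ J) (hL : 1 ≤ L)
    (a : Fin J → ℝ) (ha : ∀ j, 0 ≤ a j)
    (K : Fin J → ℕ) (hK : ∀ j, 1 ≤ K j)
    (ω : (j : Fin J) → Fin (K j) → ℝ)
    (hωsimplex : ∀ j, (∀ u, 0 ≤ ω j u) ∧ ∑ u, ω j u = 1)
    (θ : (j : Fin J) → Fin (K j) → EuclideanSpace ℝ (Fin d))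
    (D : EuclideanSpace ℝ (Fin d) → EuclideanSpace ℝ (Fin d) → ℝ)
    (hD : ∀ x y, D x y = A x - A y - ⟪gradient A y, x - y⟫)
    (Plan : (j : Fin J) → (Fin L → ℝ) → Set (Fin (K j) → Fin L → ℝ))
    (hPlan : ∀ j w, Plan j w = {π | (∀ u v, 0 ≤ π u v) ∧
      (∀ u, ∑ v, π u v = ω j u) ∧ (∀ v, ∑ u, π u v = w v)})
    (val : (j : Fin J) → (Fin L → EuclideanSpace ℝ (Fin d)) →
      (Fin (K j) → Fin L → ℝ) → ℝ)
    (hval : ∀ j Ψ π, val j Ψ π = ∑ u, ∑ v, π u v * D (θ j u) (Ψ v) +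
      lam * ∑ u, ∑ v, π u v * Real.log (π u v))
    (obj : (Fin L → ℝ) → (Fin L → EuclideanSpace ℝ (Fin d)) → ℝ)
    (hobj : ∀ w Ψ, obj w Ψ = ∑ j, a j * sInf (val j Ψ '' Plan j w))
    (w : Fin L → ℝ) (hwsimplex : (∀ v, 0 ≤ w v) ∧ ∑ v, w v = 1)
    (Ψ : Fin L → EuclideanSpace ℝ (Fin d))
    (π : (j : Fin J) → Fin (K j) → Fin L → ℝ)
    (hπmem : ∀ j, π j ∈ Plan j w)
    (hπopt : ∀ j, val j Ψ (π j) = sInf (val j Ψ '' Plan j w))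
    (S : Fin L → ℝ) (hS : ∀ v, S v = ∑ j, ∑ u, a j * π j u v) (hSpos : ∀ v, 0 < S v)
    (Ψ' : Fin L → EuclideanSpace ℝ (Fin d))
    (hΨ' : ∀ v, Ψ' v = (1 / S v) • ∑ j, ∑ u, (a j * π j u v) • θ j u) :
    obj w Ψ' ≤ obj w Ψ := by
  obtain rfl : D = bregmanDiv A := by
    funext x y
    exact hD x y
  have hbdd : ∀ j, BddBelow (val j Ψ' '' Plan j w) := by
    intro j
    refine ⟨lam * ∑ _u : Fin (K j), ∑ _v : Fin L, (-1 : ℝ), ?_⟩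
    rintro _ ⟨ρ, hρ, rfl⟩
    rw [hPlan] at hρ
    rw [hval]
    exact entropic_cost_lower_bound hlam.le
      (fun u v => bregmanDiv_nonneg hA (hA' (Ψ' v)) (θ j u)) hρ.1
  have hcost : ∀ Φ : Fin L → EuclideanSpace ℝ (Fin d),
      ∑ j, a j * val j Φ (π j) =
        ∑ v, ∑ i : (j : Fin J) × Fin (K j),
          a i.1 * π i.1 i.2 v * bregmanDiv A (θ i.1 i.2) (Φ v) +
        ∑ j, a j * (lam * ∑ u, ∑ v, π j u v * Real.log (π j u v)) := by
    intro Φ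
    simp only [hval, mul_add, sum_add_distrib]
    congr 1
    rw [sum_comm, Fintype.sum_sigma]
    simp only [mul_sum, mul_assoc]
  rw [hobj, hobj]
  calc ∑ j, a j * sInf (val j Ψ' '' Plan j w)
      ≤ ∑ j, a j * val j Ψ' (π j) := sum_le_sum fun j _ =>
        mul_le_mul_of_nonneg_left (csInf_le (hbdd j) ⟨π j, hπmem j, rfl⟩) (ha j)
    _ ≤ ∑ j, a j * val j Ψ (π j) := by
        rw [hcost, hcost]
        gcongr ?_ + _
        refine sum_le_sum fun v _ => ?_
        have hSv : ∑ i : (j : Fin J) × Fin (K j), a i.1 * π i.1 i.2 v = S v := by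
          rw [hS, Fintype.sum_sigma]
        refine sum_mul_bregmanDiv_mean_le hA (hSv ▸ hSpos v) (fun i => θ i.1 i.2) (hA' (Ψ v)) ?_
        rw [hSv, hΨ', Fintype.sum_sigma]
    _ = ∑ j, a j * sInf (val j Ψ '' Plan j w) := by simp only [hπopt]
end
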